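/- Let a = (a_1, …, a_N) be a sequence of positive integers with gcd(a_1, …, a_N) = 1, and let f = lcm(a_1, …, a_N). Then the denumerant d(t; a) is a quasi-polynomial in t of degree N − 1 with period f: there exist polynomials P_1, …, P_f ∈ ℚ[t], each of degree at most N − 1 and each having coefficient of t^{N−1} equal to 1/((N−1)! · Π_{i=1}^{N} a_i), such that d(t; a) = P_i(t) whenever t ≥ 0 and t ≡ i (mod f) (where the residue class i is taken in {1, …, f}). -/

import Mathlib

open Polynomial in
/-- The polynomial in `t` that counts the `q : Fin (n + 1) → ℕ` with `f * ∑ q + s = t`. -/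
noncomputable def simplexCountPoly (n f s : ℕ) : ℚ[X] :=
  C ((n.factorial : ℚ)⁻¹) * (ascPochhammer ℚ n).comp (C (f : ℚ)⁻¹ * X + C (1 - (s : ℚ) / f))

theorem simplexCountPoly_eval (n f s : ℕ) (t : ℚ) :
    (simplexCountPoly n f s).eval t =
      (n.factorial : ℚ)⁻¹ * (ascPochhammer ℚ n).eval ((t - s) / f + 1) := by
  simp only [simplexCountPoly, Polynomial.eval_mul, Polynomial.eval_C, Polynomial.eval_comp,
    Polynomial.eval_add, Polynomial.eval_X]
  congr 2
  ring

theorem simplexCountPoly_natDegree_le (n f s : ℕ) : (simplexCountPoly n f s).natDegree ≤ n := by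
  refine (Polynomial.natDegree_C_mul_le _ _).trans (Polynomial.natDegree_comp_le.trans ?_)
  rw [ascPochhammer_natDegree]
  exact (Nat.mul_le_mul_left n Polynomial.natDegree_linear_le).trans_eq (mul_one n)

theorem simplexCountPoly_coeff {f : ℕ} (hf : f ≠ 0) (n s : ℕ) :
    (simplexCountPoly n f s).coeff n = ((n.factorial : ℚ) * (f : ℚ) ^ n)⁻¹ := by
  have hf' : (f : ℚ)⁻¹ ≠ 0 := inv_ne_zero (Nat.cast_ne_zero.mpr hf)
  have h1 := Polynomial.natDegree_linear (b := 1 - (s : ℚ) / f) hf'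
  have h := Polynomial.coeff_comp_degree_mul_degree (p := ascPochhammer ℚ n)
    (q := Polynomial.C (f : ℚ)⁻¹ * Polynomial.X + Polynomial.C (1 - (s : ℚ) / f)) 
    (by rw [h1]; exact one_ne_zero)
  rw [h1, ascPochhammer_natDegree, mul_one, (monic_ascPochhammer ℚ n).leadingCoeff,
    Polynomial.leadingCoeff_linear hf'] at h
  rw [simplexCountPoly, Polynomial.coeff_C_mul, h, one_mul, mul_inv, inv_pow]

theorem card_sum_eq (n m : ℕ) :
    Nat.card {q : Fin (n + 1) → ℕ // ∑ j, q j = m} = (m + n).choose n := by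
  rw [← Nat.card_congr (Sym.equivNatSumOfFintype (Fin (n + 1)) m), Nat.card_eq_fintype_card,
    Sym.card_sym_eq_choose, Fintype.card_fin]
  rw [show n + 1 + m - 1 = m + n by omega, Nat.choose_symm_add]

instance finite_mul_sum_add_eq (n : ℕ) (f s t : ℕ) [NeZero f] :
    Finite {q : Fin n → ℕ // f * ∑ j, q j + s = t} := by
  refine Set.Finite.to_subtype ((Set.finite_Iic (fun _ : Fin n => t)).subset fun q hq j => ?_)
  have hq : f * ∑ j, q j + s = t := hq
  have h1 : q j ≤ ∑ j, q j := Finset.single_le_sum (fun _ _ => Nat.zero_le _) (Finset.mem_univ j)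
  have h2 : ∑ j, q j ≤ f * ∑ j, q j := Nat.le_mul_of_pos_left _ (NeZero.pos f)
  show q j ≤ t
  omega

theorem card_mul_sum_add_eq (n f s t : ℕ) [NeZero f] (hst : (s : ZMod f) = t)
    (hs : s < t + f * (n + 1)) :
    (Nat.card {q : Fin (n + 1) → ℕ // f * ∑ j, q j + s = t} : ℚ) =
      (simplexCountPoly n f s).eval (t : ℚ) := by
  have hf : (f : ℚ) ≠ 0 := Nat.cast_ne_zero.mpr (NeZero.ne f)
  have hn : (n.factorial : ℚ) ≠ 0 := Nat.cast_ne_zero.mpr n.factorial_ne_zero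
  rw [ZMod.natCast_eq_natCast_iff] at hst
  rw [simplexCountPoly_eval]
  rcases le_or_gt s t with h | h
  · obtain ⟨m, hm⟩ := (Nat.modEq_iff_dvd' h).mp hst
    obtain rfl : t = f * m + s := by omega
    have h1 : ∀ q : Fin (n + 1) → ℕ, f * ∑ j, q j + s = f * m + s ↔ ∑ j, q j = m := fun q => by
      rw [Nat.add_right_cancel_iff, Nat.mul_right_inj (NeZero.ne f)]
    simp_rw [h1]
    rw [card_sum_eq, eq_inv_mul_iff_mul_eq₀ hn]
    have h2 : (((f * m + s : ℕ) : ℚ) - s) / f + 1 = ((m + 1 : ℕ) : ℚ) := by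
      push_cast
      field_simp
      ring
    rw [h2, ← Nat.cast_ascFactorial, Nat.ascFactorial_eq_factorial_mul_choose]
    push_cast
    rfl
  · obtain ⟨k, hk⟩ := (Nat.modEq_iff_dvd' h.le).mp hst.symm
    obtain rfl : s = t + f * k := by omega
    have hk0 : k ≠ 0 := by
      rintro rfl
      simp at h
    obtain ⟨k, rfl⟩ := Nat.exists_eq_succ_of_ne_zero hk0
    have hkn : k < n := by
      have := Nat.lt_of_mul_lt_mul_left (Nat.lt_of_add_lt_add_left hs)
      omega
    have : IsEmpty {q : Fin (n + 1) → ℕ // f * ∑ j, q j + (t + f * (k + 1)) = t} :=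
      ⟨fun ⟨q, hq⟩ => by
      have hpos : 0 < f * (k + 1) := Nat.mul_pos (NeZero.pos f) k.succ_pos
      have hq : f * ∑ j, q j + (t + f * (k + 1)) = t := hq
      omega⟩
    have h2 : ((t : ℚ) - (t + f * (k + 1) : ℕ)) / f + 1 = -(k : ℚ) := by
      push_cast
      field_simp
      ring
    rw [Nat.succ_eq_add_one, Nat.card_of_isEmpty, h2, ascPochhammer_eval_neg_coe_nat_of_lt hkn]
    simp

theorem exists_sum_mul_eq_one {ι : Type*} [Fintype ι] (a : ι → ℕ) (h : Finset.univ.gcd a = 1) :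
    ∃ z : ι → ℤ, ∑ j, (a j : ℤ) * z j = 1 := by
  obtain ⟨z, hz⟩ := Finset.univ.gcd_eq_sum_mul (fun j => (a j : ℤ))
  refine ⟨z, hz.symm.trans ?_⟩
  have h1 : (Finset.univ.gcd fun j => (a j : ℤ)).natAbs ∣ Finset.univ.gcd a :=
    Finset.dvd_gcd fun j hj => Int.natCast_dvd_natCast.mp
      (Int.natAbs_dvd.mpr (Finset.gcd_dvd (f := fun j => (a j : ℤ)) hj))
  rw [h, Nat.dvd_one] at h1
  rw [← Finset.normalize_gcd, ← Int.abs_eq_normalize, Int.abs_eq_natAbs, h1, Nat.cast_one]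

/-- The homomorphism `r ↦ ∑ j, a j * r j` from `∏ j, ℤ/(b j)` to `ℤ/f`, where `a j * b j = f`. -/
def weightedSumHom {ι : Type*} [Fintype ι] {a b : ι → ℕ} {f : ℕ} (hab : ∀ j, a j * b j = f) :
    (∀ j, ZMod (b j)) →+ ZMod f where
  toFun r := ∑ j, ZMod.lift (b j) ⟨zmultiplesHom (ZMod f) (a j : ZMod f), by
    simp [← Nat.cast_mul, mul_comm (b j), hab]⟩ (r j)
  map_zero' := by simp
  map_add' r s := by simp [Finset.sum_add_distrib]

theorem weightedSumHom_intCast {ι : Type*} [Fintype ι] {a b : ι → ℕ} {f : ℕ}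
    (hab : ∀ j, a j * b j = f) (z : ι → ℤ) :
    weightedSumHom hab (fun j => (z j : ZMod (b j))) = ((∑ j, (a j : ℤ) * z j : ℤ) : ZMod f) := by
  simp [weightedSumHom, mul_comm]

theorem weightedSumHom_eq_val {ι : Type*} [Fintype ι] {a b : ι → ℕ} {f : ℕ}
    (hab : ∀ j, a j * b j = f) [∀ j, NeZero (b j)] (r : ∀ j, ZMod (b j)) :
    weightedSumHom hab r = ((∑ j, a j * (r j).val : ℕ) : ZMod f) := by
  have h := weightedSumHom_intCast hab (fun j => ((r j).val : ℤ))
  simpa using h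

theorem weightedSumHom_surjective {ι : Type*} [Fintype ι] {a b : ι → ℕ} {f : ℕ}
    (hab : ∀ j, a j * b j = f) (h : Finset.univ.gcd a = 1) :
    Function.Surjective (weightedSumHom hab) := by
  intro y
  obtain ⟨z, hz⟩ := exists_sum_mul_eq_one a h
  obtain ⟨y, rfl⟩ := ZMod.intCast_surjective y
  refine ⟨fun j => ((z j * y : ℤ) : ZMod (b j)), ?_⟩
  rw [weightedSumHom_intCast hab (fun j => z j * y)]
  simp_rw [← mul_assoc]
  rw [← Finset.sum_mul, hz, one_mul]

theorem mul_card_fiber_eq {G H : Type*} [AddGroup G] [AddGroup H] [Fintype G] [Fintype H]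
    [DecidableEq H] (φ : G →+ H) (hφ : Function.Surjective φ) (y : H) :
    Fintype.card H * (Finset.univ.filter fun g => φ g = y).card = Fintype.card G := by
  have h := Finset.card_eq_sum_card_fiberwise (s := (Finset.univ : Finset G)) (f := φ)
    (t := Finset.univ) (fun _ _ => Finset.mem_coe.mpr (Finset.mem_univ _))
  rw [Finset.sum_congr rfl fun x _ => AddMonoidHom.card_fiber_eq_of_mem_range φ (hφ x) (hφ y)] at h
  simpa using h.symm

/-- Division with remainder by `b j` in each coordinate. -/
def solutionsEquivSigma {ι : Type*} [Fintype ι] {a b : ι → ℕ} {f : ℕ}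
    (hab : ∀ j, a j * b j = f) [∀ j, NeZero (b j)] (t : ℕ) :
    {x : ι → ℕ // ∑ j, a j * x j = t} ≃
      Σ r : ∀ j, ZMod (b j), {q : ι → ℕ // f * ∑ j, q j + ∑ j, a j * (r j).val = t} where
  toFun x := ⟨fun j => (x.1 j : ZMod (b j)), fun j => x.1 j / b j, by
    refine Eq.trans ?_ x.2
    rw [Finset.mul_sum, ← Finset.sum_add_distrib]
    refine Finset.sum_congr rfl fun j _ => ?_
    rw [ZMod.val_natCast, ← hab j, mul_assoc, ← mul_add, Nat.div_add_mod]⟩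
  invFun y := ⟨fun j => b j * y.2.1 j + (y.1 j).val, by
    refine Eq.trans ?_ y.2.2
    rw [Finset.mul_sum, ← Finset.sum_add_distrib]
    refine Finset.sum_congr rfl fun j _ => ?_
    rw [mul_add, ← mul_assoc, hab j]⟩
  left_inv x := by
    ext j
    simp [ZMod.val_natCast, Nat.div_add_mod]
  right_inv := by
    rintro ⟨r, q, hq⟩
    have h1 : (fun j => ((b j * q j + (r j).val : ℕ) : ZMod (b j))) = r := by
      funext j
      simp
    have h2 : (fun j => (b j * q j + (r j).val) / b j) = q := by
      funext j
      rw [Nat.mul_add_div (NeZero.pos _), Nat.div_eq_of_lt (ZMod.val_lt _), add_zero]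
    refine Sigma.subtype_ext ?_ ?_
    · exact h1
    · exact h2

/-- For positive integers `a_1, …, a_N` with `gcd = 1` and `f = lcm(a_1, …, a_N)`,
the denumerant `d(t; a)` is a quasi-polynomial in `t` of degree `N - 1` with period `f`:
there are polynomials `P_1, …, P_f ∈ ℚ[t]`, each of degree at most `N - 1` with coefficient of
`t^{N-1}` equal to `1/((N-1)! ∏ a_i)`, such that `d(t; a) = P_i(t)` whenever `t ≡ i (mod f)`
with the residue class `i` taken in `{1, …, f}`. -/
theorem denumerant_quasiPolynomial (N : ℕ) (a : Fin N → ℕ) (ha : ∀ i, 0 < a i)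
    (hgcd : Finset.univ.gcd a = 1) (f : ℕ) (hf : f = Finset.univ.lcm a) :
    ∃ P : ℕ → Polynomial ℚ,
      (∀ i, 1 ≤ i → i ≤ f → (P i).degree ≤ (N - 1 : ℕ)) ∧
      (∀ i, 1 ≤ i → i ≤ f →
        (P i).coeff (N - 1) = 1 / ((N - 1).factorial * ∏ j, (a j : ℚ))) ∧
      (∀ t : ℕ, ∀ i, 1 ≤ i → i ≤ f → t % f = i % f →
        (Nat.card {x : Fin N → ℕ // ∑ j, a j * x j = t} : ℚ) = (P i).eval (t : ℚ)) := by
  have hb : ∀ j, ∃ b, a j * b = f := fun j => by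
    obtain ⟨b, h⟩ := Finset.dvd_lcm (f := a) (Finset.mem_univ j)
    exact ⟨b, by rw [hf, h]⟩
  choose b hab using hb
  have hf0 : f ≠ 0 := by
    rw [hf, Ne, Finset.lcm_eq_zero_iff]
    rintro ⟨j, -, hj⟩
    exact (ha j).ne' hj
  have : NeZero f := ⟨hf0⟩
  have : ∀ j, NeZero (b j) := fun j => ⟨fun h => hf0 (by rw [← hab j, h, mul_zero])⟩
  obtain _ | n := N
  · simp at hgcd
  simp only [Nat.add_sub_cancel]
  let s : (∀ j, ZMod (b j)) → ℕ := fun r => ∑ j, a j * (r j).val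
  refine ⟨fun i => ∑ r with weightedSumHom hab r = (i : ZMod f), simplexCountPoly n f (s r),
    fun i _ _ => ?_, fun i _ _ => ?_, fun t i _ _ hti => ?_⟩
  · exact Polynomial.degree_le_of_natDegree_le
      (Polynomial.natDegree_sum_le_of_forall_le _ _ fun r _ => simplexCountPoly_natDegree_le n f _)
  · have hcard := mul_card_fiber_eq _ (weightedSumHom_surjective hab hgcd) (i : ZMod f)
    rw [ZMod.card, Fintype.card_pi] at hcard
    simp only [ZMod.card] at hcard
    have hprod : (∏ j, a j) * ∏ j, b j = f ^ (n + 1) := by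
      simp [← Finset.prod_mul_distrib, hab]
    rw [Polynomial.finsetSum_coeff, Finset.sum_congr rfl fun r _ => simplexCountPoly_coeff hf0 n _,
      Finset.sum_const, nsmul_eq_mul]
    rw [← hcard, pow_succ', mul_left_comm, Nat.mul_right_inj hf0] at hprod
    have hfn : (f : ℚ) ^ n ≠ 0 := pow_ne_zero _ (Nat.cast_ne_zero.mpr hf0)
    have ha0 : (∏ j, (a j : ℚ)) ≠ 0 :=
      Finset.prod_ne_zero_iff.mpr fun j _ => Nat.cast_ne_zero.mpr (ha j).ne'
    have hn : (n.factorial : ℚ) ≠ 0 := Nat.cast_ne_zero.mpr n.factorial_ne_zero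
    replace hprod := congrArg (Nat.cast : ℕ → ℚ) hprod
    push_cast at hprod
    rw [← div_eq_mul_inv, div_eq_div_iff (mul_ne_zero hn hfn) (mul_ne_zero hn ha0), ← hprod]
    ring
  · have hti' : (i : ZMod f) = t := ((ZMod.natCast_eq_natCast_iff t i f).mpr hti).symm
    rw [Nat.card_congr (solutionsEquivSigma hab t), Nat.card_sigma, Polynomial.eval_finsetSum,
      Finset.sum_filter, Nat.cast_sum]
    refine Finset.sum_congr rfl fun r _ => ?_
    rw [weightedSumHom_eq_val, hti']
    split_ifs with h
    · refine card_mul_sum_add_eq n f (s r) t h (lt_of_lt_of_le ?_ (Nat.le_add_left _ t))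
      calc s r < ∑ _j : Fin (n + 1), f :=
            Finset.sum_lt_sum_of_nonempty Finset.univ_nonempty fun j _ => by
              rw [← hab j]
              exact Nat.mul_lt_mul_of_pos_left (ZMod.val_lt _) (ha j)
        _ = f * (n + 1) := by simp [mul_comm]
    · have : IsEmpty {q : Fin (n + 1) → ℕ // f * ∑ j, q j + ∑ j, a j * (r j).val = t} :=
        ⟨fun ⟨q, hq⟩ => h (by simp [← hq])⟩
      simp
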